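/- arXiv:2210.03111 — 7 statements merged into one kernel-verified Lean document; each statement's English description precedes it below -/
import Mathlib

section
/- Let A ⊂ V = ℂ^N be a finite set of nonzero vectors with multiplicities c_α ∈ ℂ, and let F(x) = Σ_{α∈A} c_α f((α,x)) where f'''(z) = cot z. Then the commutativity equations F_i F_j = F_j F_i (i,j = 1,…,N) for F are equivalent to the identity Σ_{α,β∈A} c_α c_β (α,β) cot(α,x) cot(β,x) B_{α,β}(a,b) (α∧β) = 0 holding for all a,b ∈ V and all x in the common domain, where B_{α,β}(a,b) = (α,a)(β,b) − (α,b)(β,a) and the bivector identity means that pairing with any further pair a',b' ∈ V gives Σ_{α,β∈A} c_α c_β (α,β) cot(α,x) cot(β,x) B_{α,β}(a,b) B_{α,β}(a',b') = 0. -/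
open scoped BigOperators

noncomputable def pd {N : ℕ} (i : Fin N) (f : (Fin N → ℂ) → ℂ) : (Fin N → ℂ) → ℂ :=
  fun x => fderiv ℂ f x (Pi.single i 1)

noncomputable def D3 {N : ℕ} (F : (Fin N → ℂ) → ℂ) (i p q : Fin N) (x : Fin N → ℂ) : ℂ :=
  pd i (pd p (pd q F)) x

noncomputable def Fmat {N : ℕ} (F : (Fin N → ℂ) → ℂ) (i : Fin N) (x : Fin N → ℂ) :
    Matrix (Fin N) (Fin N) ℂ :=
  Matrix.of fun p q => D3 F i p q x

/-- The standard bilinear form on `ℂ^N`. -/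
noncomputable def dotc {N : ℕ} (u v : Fin N → ℂ) : ℂ := ∑ k, u k * v k

/-- Complex cotangent. -/
noncomputable def ccot (z : ℂ) : ℂ := Complex.cos z / Complex.sin z

open Matrix Topology

/-- The linear functional `dotc α` as a continuous linear map. -/
noncomputable def dotcCLM {N : ℕ} (α : Fin N → ℂ) : (Fin N → ℂ) →L[ℂ] ℂ :=
  ∑ k, α k • ContinuousLinearMap.proj k

theorem dotcCLM_apply {N : ℕ} (α x : Fin N → ℂ) : dotcCLM α x = dotc α x := by
  simp [dotcCLM, dotc]

theorem dotc_single {N : ℕ} (α : Fin N → ℂ) (i : Fin N) : dotc α (Pi.single i 1) = α i := by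
  simp [dotc, Pi.single_apply]

theorem hasFDerivAt_dotc {N : ℕ} (α x : Fin N → ℂ) :
    HasFDerivAt (fun y => dotc α y) (dotcCLM α) x := by
  have h : (fun y => dotc α y) = dotcCLM α := funext fun y => (dotcCLM_apply α y).symm
  exact h ▸ (dotcCLM α).hasFDerivAt

theorem isOpen_setOf_dotc_mem {N : ℕ} (A : Finset (Fin N → ℂ)) {Ω : Set ℂ} (hΩ : IsOpen Ω) :
    IsOpen {x : Fin N → ℂ | ∀ α ∈ A, dotc α x ∈ Ω} := by
  have h : {x : Fin N → ℂ | ∀ α ∈ A, dotc α x ∈ Ω} = ⋂ α ∈ A, dotcCLM α ⁻¹' Ω := by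
    ext x
    simp [dotcCLM_apply]
  rw [h]
  exact isOpen_biInter_finset fun α _ => hΩ.preimage (dotcCLM α).continuous

theorem pd_sum_comp_dotc {N : ℕ} (A : Finset (Fin N → ℂ)) (c : (Fin N → ℂ) → ℂ) (g : ℂ → ℂ)
    (i : Fin N) (x : Fin N → ℂ) (hg : ∀ α ∈ A, DifferentiableAt ℂ g (dotc α x)) :
    pd i (fun y => ∑ α ∈ A, c α * g (dotc α y)) x =
      ∑ α ∈ A, c α * α i * deriv g (dotc α x) := by
  have h := HasFDerivAt.fun_sum (u := A) fun α hα =>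
    (((hg α hα).hasDerivAt.comp_hasFDerivAt x (hasFDerivAt_dotc α x)).const_mul (c α))
  have h' : pd i (fun y => ∑ α ∈ A, c α * g (dotc α y)) x = _ :=
    congrArg (fun L : (Fin N → ℂ) →L[ℂ] ℂ => L (Pi.single i 1)) h.fderiv
  rw [h']
  simp only [FunLike.coe_sum, Finset.sum_apply, FunLike.coe_smul, Pi.smul_apply,
    dotcCLM_apply, dotc_single, smul_eq_mul]
  exact Finset.sum_congr rfl fun α _ => by ring

theorem pd_congr_of_eqOn {N : ℕ} {U : Set (Fin N → ℂ)} (hU : IsOpen U)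
    {F G : (Fin N → ℂ) → ℂ} (h : Set.EqOn F G U) (i : Fin N) :
    Set.EqOn (pd i F) (pd i G) U := fun x hx => by
  have : F =ᶠ[𝓝 x] G := h.eventuallyEq_of_mem (hU.mem_nhds hx)
  simp only [pd, this.fderiv_eq]

theorem D3_sum_comp_dotc {N : ℕ} (A : Finset (Fin N → ℂ)) (c : (Fin N → ℂ) → ℂ)
    {Ω : Set ℂ} (hΩ : IsOpen Ω) {f : ℂ → ℂ} (hf : DifferentiableOn ℂ f Ω)
    (i p q : Fin N) (x : Fin N → ℂ) (hx : ∀ α ∈ A, dotc α x ∈ Ω) :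
    D3 (fun y => ∑ α ∈ A, c α * f (dotc α y)) i p q x =
      ∑ α ∈ A, c α * α q * α p * α i * deriv (deriv (deriv f)) (dotc α x) := by
  have hU := isOpen_setOf_dotc_mem A hΩ
  have step (c : (Fin N → ℂ) → ℂ) {g : ℂ → ℂ} (hg : DifferentiableOn ℂ g Ω) (j : Fin N) :
      Set.EqOn (pd j (fun y => ∑ α ∈ A, c α * g (dotc α y)))
        (fun y => ∑ α ∈ A, c α * α j * deriv g (dotc α y))
        {y | ∀ α ∈ A, dotc α y ∈ Ω} := fun y hy =>
    pd_sum_comp_dotc A c g j y fun α hα => hg.differentiableAt (hΩ.mem_nhds (hy α hα))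
  have hf₁ := hf.deriv hΩ
  have h₁ := step c hf q
  have h₂ := (pd_congr_of_eqOn hU h₁ p).trans (step (fun α => c α * α q) hf₁ p)
  have h₃ := (pd_congr_of_eqOn hU h₂ i).trans
    (step (fun α => c α * α q * α p) (hf₁.deriv hΩ) i)
  exact h₃ hx

/-- The matrix `∑ α, k α (α, a) α αᵀ`, i.e. the contraction of the cubic form
`∑ α, k α α ⊗ α ⊗ α` with the vector `a`. -/
noncomputable def cubicMat {N : ℕ} (A : Finset (Fin N → ℂ)) (k : (Fin N → ℂ) → ℂ)
    (a : Fin N → ℂ) : Matrix (Fin N) (Fin N) ℂ :=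
  ∑ α ∈ A, (k α * dotc α a) • vecMulVec α α

theorem cubicMat_eq_sum_single {N : ℕ} (A : Finset (Fin N → ℂ)) (k : (Fin N → ℂ) → ℂ)
    (a : Fin N → ℂ) : cubicMat A k a = ∑ i, a i • cubicMat A k (Pi.single i 1) := by
  simp only [cubicMat, Finset.smul_sum, dotc_single]
  rw [Finset.sum_comm]
  refine Finset.sum_congr rfl fun α _ => ?_
  simp only [smul_smul, ← Finset.sum_smul, dotc, Finset.mul_sum]
  exact congrArg (· • _) (Finset.sum_congr rfl fun i _ => by ring)

theorem commute_cubicMat_of_single {N : ℕ} {A : Finset (Fin N → ℂ)} {k : (Fin N → ℂ) → ℂ}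
    (h : ∀ i j, Commute (cubicMat A k (Pi.single i 1)) (cubicMat A k (Pi.single j 1)))
    (a b : Fin N → ℂ) : Commute (cubicMat A k a) (cubicMat A k b) := by
  rw [cubicMat_eq_sum_single A k a, cubicMat_eq_sum_single A k b]
  exact Commute.sum_left _ _ _ fun i _ => Commute.sum_right _ _ _ fun j _ =>
    ((h i j).smul_left _).smul_right _

theorem dotProduct_cubicMat_mul_mulVec {N : ℕ} (A : Finset (Fin N → ℂ)) (k : (Fin N → ℂ) → ℂ)
    (a b u v : Fin N → ℂ) :
    u ⬝ᵥ ((cubicMat A k a * cubicMat A k b) *ᵥ v) =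
      ∑ α ∈ A, ∑ β ∈ A, k α * k β * dotc α β * dotc α a * dotc β b * dotc α u * dotc β v := by
  have hd (x y : Fin N → ℂ) : x ⬝ᵥ y = dotc x y := rfl
  simp only [cubicMat, Finset.sum_mul, Finset.mul_sum, sum_mulVec, dotProduct_sum,
    smul_mul_assoc, mul_smul_comm, smul_mulVec, dotProduct_smul, vecMulVec_mul_vecMulVec,
    vecMulVec_mulVec, smul_eq_mul, op_smul_eq_smul, smul_dotProduct]
  simp only [hd]
  rw [Finset.sum_comm]
  refine Finset.sum_congr rfl fun α _ => Finset.sum_congr rfl fun β _ => ?_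
  rw [← hd u α, dotProduct_comm u α, hd]
  ring

/-- The bivector sum is twice the matrix coefficient of a commutator. -/
theorem sum_bivector_eq {N : ℕ} (A : Finset (Fin N → ℂ)) (k : (Fin N → ℂ) → ℂ)
    (a b u v : Fin N → ℂ) :
    ∑ α ∈ A, ∑ β ∈ A, k α * k β * dotc α β * (dotc α a * dotc β b - dotc α b * dotc β a) *
        (dotc α u * dotc β v - dotc α v * dotc β u) =
      2 * (u ⬝ᵥ ((cubicMat A k a * cubicMat A k b) *ᵥ v) -
        u ⬝ᵥ ((cubicMat A k b * cubicMat A k a) *ᵥ v)) := by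
  have hswap : ∑ α ∈ A, ∑ β ∈ A, k α * k β * dotc α β *
        (dotc α a * dotc β b - dotc α b * dotc β a) * (dotc α v * dotc β u) =
      -∑ α ∈ A, ∑ β ∈ A, k α * k β * dotc α β *
        (dotc α a * dotc β b - dotc α b * dotc β a) * (dotc α u * dotc β v) := by
    rw [Finset.sum_comm]
    simp only [← Finset.sum_neg_distrib]
    refine Finset.sum_congr rfl fun α _ => Finset.sum_congr rfl fun β _ => ?_
    rw [show dotc β α = dotc α β from dotProduct_comm β α]
    ring
  have hmain : u ⬝ᵥ ((cubicMat A k a * cubicMat A k b) *ᵥ v) -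
        u ⬝ᵥ ((cubicMat A k b * cubicMat A k a) *ᵥ v) =
      ∑ α ∈ A, ∑ β ∈ A, k α * k β * dotc α β *
        (dotc α a * dotc β b - dotc α b * dotc β a) * (dotc α u * dotc β v) := by
    simp only [dotProduct_cubicMat_mul_mulVec, ← Finset.sum_sub_distrib]
    exact Finset.sum_congr rfl fun α _ => Finset.sum_congr rfl fun β _ => by ring
  simp only [mul_sub (_ * (_ - _)), Finset.sum_sub_distrib]
  rw [hswap, hmain]
  ring

theorem forall_commute_cubicMat_iff {N : ℕ} (A : Finset (Fin N → ℂ)) (k : (Fin N → ℂ) → ℂ) :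
    (∀ i j, Commute (cubicMat A k (Pi.single i 1)) (cubicMat A k (Pi.single j 1))) ↔
      ∀ a b u v : Fin N → ℂ, ∑ α ∈ A, ∑ β ∈ A, k α * k β * dotc α β *
        (dotc α a * dotc β b - dotc α b * dotc β a) *
        (dotc α u * dotc β v - dotc α v * dotc β u) = 0 := by
  simp only [sum_bivector_eq]
  constructor
  · intro h a b u v
    rw [(commute_cubicMat_of_single h a b).eq, sub_self, mul_zero]
  · intro h i j
    ext p q
    have := h (Pi.single i 1) (Pi.single j 1) (Pi.single p 1) (Pi.single q 1)
    simpa [sub_eq_zero] using this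

theorem Fmat_sum_comp_dotc {N : ℕ} (A : Finset (Fin N → ℂ)) (c : (Fin N → ℂ) → ℂ)
    {Ω : Set ℂ} (hΩ : IsOpen Ω) {f : ℂ → ℂ} (hf : DifferentiableOn ℂ f Ω)
    (i : Fin N) (x : Fin N → ℂ) (hx : ∀ α ∈ A, dotc α x ∈ Ω) :
    Fmat (fun y => ∑ α ∈ A, c α * f (dotc α y)) i x =
      cubicMat A (fun α => c α * deriv (deriv (deriv f)) (dotc α x)) (Pi.single i 1) := by
  ext p q
  simp only [Fmat, of_apply, D3_sum_comp_dotc A c hΩ hf i p q x hx, cubicMat, Matrix.sum_apply,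
    Matrix.smul_apply, vecMulVec_apply, smul_eq_mul, dotc_single]
  exact Finset.sum_congr rfl fun α _ => by ring

/-- for the trigonometric prepotential
`F(x) = Σ_{α∈A} c_α f((α,x))` with `f''' = cot` (with `f` holomorphic on an
open set `Ω` avoiding the poles of `cot`), the commutativity equations
`F_i F_j = F_j F_i` on the common domain are equivalent to the bivector
identity
`Σ_{α,β∈A} c_α c_β (α,β) cot(α,x) cot(β,x) B_{α,β}(a,b) (α∧β) = 0`. -/
theorem stmt1 {N : ℕ} (A : Finset (Fin N → ℂ)) (hA0 : ∀ α ∈ A, α ≠ 0)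
    (c : (Fin N → ℂ) → ℂ) (Ω : Set ℂ) (hΩ : IsOpen Ω)
    (hΩsin : ∀ z ∈ Ω, Complex.sin z ≠ 0)
    (f : ℂ → ℂ) (hf : ContDiffOn ℂ ⊤ f Ω)
    (hf3 : ∀ z ∈ Ω, deriv (deriv (deriv f)) z = ccot z)
    (F : (Fin N → ℂ) → ℂ) (hF : F = fun x => ∑ α ∈ A, c α * f (dotc α x)) :
    (∀ x, (∀ α ∈ A, dotc α x ∈ Ω) →
      ∀ i j : Fin N, Fmat F i x * Fmat F j x = Fmat F j x * Fmat F i x)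
    ↔
    (∀ x, (∀ α ∈ A, dotc α x ∈ Ω) →
      ∀ a b a' b' : Fin N → ℂ,
        ∑ α ∈ A, ∑ β ∈ A,
          c α * c β * dotc α β * ccot (dotc α x) * ccot (dotc β x) *
            (dotc α a * dotc β b - dotc α b * dotc β a) *
            (dotc α a' * dotc β b' - dotc α b' * dotc β a') = 0) := by
  have hd : DifferentiableOn ℂ f Ω := hf.differentiableOn (by simp)
  subst hF
  refine forall₂_congr fun x hx => ?_
  simp only [Fmat_sum_comp_dotc A c hΩ hd _ x hx]
  refine (forall_commute_cubicMat_iff A _).trans ?_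
  refine forall₄_congr fun a b u v => ?_
  refine Eq.congr_left (Finset.sum_congr rfl fun α hα => Finset.sum_congr rfl fun β hβ => ?_)
  rw [hf3 _ (hx α hα), hf3 _ (hx β hβ)]
  ring
end

section
/- Let R be a crystallographic root system in a Euclidean space V (so that for α,β ∈ R one has 2(α,β)/(α,α) ∈ ℤ and the reflection s_α β = β − (2(α,β)/(α,α))α belongs to R), and let c: R → ℂ be a multiplicity function invariant under the Weyl group of R. Then (R,c) is a Euclidean trigonometric ∨-system: for every α ∈ R and every α-string Γ_α^s, Σ_{β∈Γ_α^s} c_β (α,β) α∧β = 0. -/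
open scoped BigOperators

/-- `γ` is collinear to `α`. -/
def Collin {V : Type*} [AddCommGroup V] [Module ℂ V] (α γ : V) : Prop :=
  ∃ k : ℂ, γ = k • α

/-- `Γ` is a (maximal, nonempty) `α`-string of the configuration `A`. -/
def IsString {V : Type*} [AddCommGroup V] [Module ℂ V]
    (A : Finset V) (α : V) (Γ : Finset V) : Prop :=
  Γ.Nonempty ∧
  (∀ γ ∈ Γ, γ ∈ A ∧ ¬ Collin α γ) ∧
  (∀ γ₁ ∈ Γ, ∀ γ₂ ∈ Γ, ∃ m : ℤ, γ₁ + γ₂ = (m : ℂ) • α ∨ γ₁ - γ₂ = (m : ℂ) • α) ∧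
  (∀ γ ∈ Γ, ∀ β ∈ A, ¬ Collin α β →
    (∃ m : ℤ, β = γ + (m : ℂ) • α ∨ β = -γ + (m : ℂ) • α) → β ∈ Γ)

/-- `(A, c)` is a Euclidean trigonometric ∨-system with respect to the
bilinear form `g`: for every `α ∈ A` and every `α`-string `Γ`,
`Σ_{β∈Γ} c_β (α,β) α∧β = 0`. -/
def IsEuclidTrigVSystem {V : Type*} [AddCommGroup V] [Module ℂ V]
    (g : V → V → ℂ) (A : Finset V) (c : V → ℂ) : Prop :=
  ∀ α ∈ A, ∀ Γ : Finset V, IsString A α Γ →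
    ∀ a b : V, ∑ β ∈ Γ, c β * g α β * (g α a * g β b - g α b * g β a) = 0

/-- a crystallographic root system with Weyl-invariant
multiplicities is a Euclidean trigonometric ∨-system. -/
theorem stmt3 {V : Type*} [AddCommGroup V] [Module ℂ V]
    (g : V →ₗ[ℂ] V →ₗ[ℂ] ℂ)
    (hgsymm : ∀ u v : V, g u v = g v u)
    (hgnondeg : ∀ v : V, (∀ w : V, g v w = 0) → v = 0)
    (R : Finset V) (hR0 : ∀ α ∈ R, α ≠ 0)
    (hRaniso : ∀ α ∈ R, g α α ≠ 0)
    (hcrys : ∀ α ∈ R, ∀ β ∈ R, ∃ m : ℤ, 2 * g α β = (m : ℂ) * g α α)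
    (hrefl : ∀ α ∈ R, ∀ β ∈ R, β - (2 * g α β / g α α) • α ∈ R)
    (c : V → ℂ)
    (hcW : ∀ α ∈ R, ∀ β ∈ R, c (β - (2 * g α β / g α α) • α) = c β) :
    IsEuclidTrigVSystem (fun u v => g u v) R c := by
  rintro α hα Γ ⟨-, hΓR, -, hΓmax⟩ a b
  have hαα := hRaniso α hα
  -- The reflection in `α` negates the pairing with `α`.
  have hpair : ∀ β, g α (β - (2 * g α β / g α α) • α) = -g α β := by
    intro β
    simp only [map_sub, map_smul, smul_eq_mul]
    field_simp
    ring
  -- The summands at `β` and at its reflection cancel.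
  refine Finset.sum_involution (fun β _ => β - (2 * g α β / g α α) • α) ?_ ?_ ?_ ?_
  · intro β hβ
    simp only [hcW α hα β (hΓR β hβ).1, hpair]
    simp only [map_sub, map_smul, LinearMap.sub_apply, LinearMap.smul_apply, smul_eq_mul]
    ring
  · intro β _ hne hfix
    refine hne ?_
    have hzero : g α β = 0 := by
      have h := hpair β
      rw [hfix] at h
      exact self_eq_neg.mp h
    simp [hzero]
  · intro β hβ
    obtain ⟨hβR, hβα⟩ := hΓR β hβ
    refine hΓmax β hβ _ (hrefl α hα β hβR) ?_ ?_
    · rintro ⟨k, hk⟩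
      exact hβα ⟨k + 2 * g α β / g α α, by rw [add_smul, ← hk, sub_add_cancel]⟩
    · obtain ⟨m, hm⟩ := hcrys α hα β hβR
      refine ⟨-m, Or.inl ?_⟩
      rw [hm, mul_div_cancel_right₀ _ hαα, Int.cast_neg, neg_smul, sub_eq_add_neg]
  · intro β _
    simp only [hpair]
    rw [mul_neg, neg_div, neg_smul, sub_neg_eq_add, sub_add_cancel]
end

section
/- Let (A,c) be a Euclidean trigonometric ∨-system in V and let B = A ∩ W be a subsystem, where W ⊆ V is a linear subspace with ⟨B⟩ = W, equipped with the restricted multiplicity function c|_B. If B is non-isotropic (i.e. the restriction of the bilinear form (·,·) to W is non-degenerate), then (B, c|_B) is also a Euclidean trigonometric ∨-system. -/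
open scoped BigOperators

/-- For `α ∈ W`, every `α`-string of `A ∩ W` is an `α`-string of `A`. -/
theorem IsString.of_inter_submodule {V : Type*} [AddCommGroup V] [Module ℂ V]
    {A B Γ : Finset V} {W : Submodule ℂ V} {α : V}
    (hB : ∀ v : V, v ∈ B ↔ v ∈ A ∧ v ∈ W) (hα : α ∈ W) (hΓ : IsString B α Γ) :
    IsString A α Γ := by
  obtain ⟨hne, hmem, hdiff, hmax⟩ := hΓ
  refine ⟨hne, fun γ hγ => ⟨((hB γ).1 (hmem γ hγ).1).1, (hmem γ hγ).2⟩, hdiff,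
    fun γ hγ β hβ hcol hm => hmax γ hγ β ((hB β).2 ⟨hβ, ?_⟩) hcol hm⟩
  have hγW : γ ∈ W := ((hB γ).1 (hmem γ hγ).1).2
  obtain ⟨m, rfl | rfl⟩ := hm
  · exact W.add_mem hγW (W.smul_mem _ hα)
  · exact W.add_mem (W.neg_mem hγW) (W.smul_mem _ hα)

/-- a non-isotropic subsystem `B = A ∩ W` of a Euclidean
trigonometric ∨-system is again a Euclidean trigonometric ∨-system. -/
theorem stmt4 {V : Type*} [AddCommGroup V] [Module ℂ V]
    (g : V →ₗ[ℂ] V →ₗ[ℂ] ℂ)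
    (hgsymm : ∀ u v : V, g u v = g v u)
    (hgnondeg : ∀ v : V, (∀ w : V, g v w = 0) → v = 0)
    (A : Finset V) (hA0 : ∀ α ∈ A, α ≠ 0) (c : V → ℂ)
    (hA : IsEuclidTrigVSystem (fun u v => g u v) A c)
    (W : Submodule ℂ V) (B : Finset V)
    (hB : ∀ v : V, v ∈ B ↔ v ∈ A ∧ v ∈ W)
    (hspan : Submodule.span ℂ (B : Set V) = W)
    (hnoniso : ∀ w ∈ W, (∀ w' ∈ W, g w w' = 0) → w = 0) :
    IsEuclidTrigVSystem (fun u v => g u v) B c := by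
  exact fun α hα Γ hΓ =>
    hA α ((hB α).1 hα).1 Γ (hΓ.of_inter_submodule hB ((hB α).1 hα).2)
end

section
/- Let (A,c) be a Euclidean trigonometric ∨-system in V with linear span ⟨A⟩ = V, and let M: V → V be the linear operator M = Σ_{β∈A} c_β β⊗β, i.e. M(u) = Σ_{β∈A} c_β (β,u) β. Then (1) every α ∈ A is an eigenvector of M, and (2) V decomposes as a direct sum V = V₁ ⊕ ⋯ ⊕ V_k where M restricted to V_i equals λ_i·Id for scalars λ_i ∈ ℂ with λ_i ≠ λ_j for i ≠ j. -/
open scoped BigOperators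

/-- Two vectors are equivalent when they agree up to sign and integer multiples of `α`. -/
def stringSetoid {V : Type*} [AddCommGroup V] [Module ℂ V] (α : V) : Setoid V where
  r β γ := ∃ m : ℤ, β = γ + (m : ℂ) • α ∨ β = -γ + (m : ℂ) • α
  iseqv :=
    { refl := fun β => ⟨0, Or.inl (by simp)⟩
      symm := by
        rintro β γ ⟨m, rfl | rfl⟩
        · exact ⟨-m, Or.inl (by push_cast; module)⟩
        · exact ⟨m, Or.inr (by module)⟩
      trans := by
        rintro β γ δ ⟨m, rfl | rfl⟩ ⟨n, rfl | rfl⟩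
        · exact ⟨n + m, Or.inl (by push_cast; module)⟩
        · exact ⟨n + m, Or.inr (by push_cast; module)⟩
        · exact ⟨m - n, Or.inr (by push_cast; module)⟩
        · exact ⟨m - n, Or.inl (by push_cast; module)⟩ }

open Classical in
/-- The equivalence classes of `stringSetoid α` among the non-collinear vectors are `α`-strings. -/
theorem isString_filter_stringSetoid {V : Type*} [AddCommGroup V] [Module ℂ V]
    {A : Finset V} {α x : V} (hx : x ∈ A.filter fun β => ¬ Collin α β) :
    IsString A α ((A.filter fun β => ¬ Collin α β).filter fun β => stringSetoid α β x) := by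
  refine ⟨⟨x, Finset.mem_filter.2 ⟨hx, (stringSetoid α).refl x⟩⟩, fun γ hγ => ?_,
    fun γ₁ h₁ γ₂ h₂ => ?_, fun γ hγ β hβ hc h => ?_⟩
  · simpa using (Finset.mem_filter.1 hγ).1
  · obtain ⟨m, h | h⟩ := (stringSetoid α).trans (Finset.mem_filter.1 h₁).2
      ((stringSetoid α).symm (Finset.mem_filter.1 h₂).2)
    · exact ⟨m, Or.inr (by rw [h]; module)⟩
    · exact ⟨m, Or.inl (by rw [h]; module)⟩
  · exact Finset.mem_filter.2 ⟨Finset.mem_filter.2 ⟨hβ, hc⟩,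
      (stringSetoid α).trans h (Finset.mem_filter.1 hγ).2⟩

/-- Summing the string conditions over all strings and the collinear vectors. -/
theorem IsEuclidTrigVSystem.sum_eq_zero {V : Type*} [AddCommGroup V] [Module ℂ V]
    {g : V →ₗ[ℂ] V →ₗ[ℂ] ℂ} {A : Finset V} {c : V → ℂ}
    (hA : IsEuclidTrigVSystem (fun u v => g u v) A c) {α : V} (hα : α ∈ A) (a b : V) :
    ∑ β ∈ A, c β * g α β * (g α a * g β b - g α b * g β a) = 0 := by
  classical
  rw [← Finset.sum_filter_add_sum_filter_not A (fun β => Collin α β)]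
  rw [Finset.sum_eq_zero, zero_add]
  · exact Finset.sum_cancels_of_partition_cancels (stringSetoid α) fun x hx =>
      hA α hα _ (isString_filter_stringSetoid hx) a b
  · intro β hβ
    obtain ⟨k, rfl⟩ := (Finset.mem_filter.1 hβ).2
    simp only [map_smul, LinearMap.smul_apply, smul_eq_mul]
    ring

/-- A vector whose wedge product with a nonzero vector vanishes is proportional to it. -/
theorem exists_eq_smul_of_wedge_eq_zero {V : Type*} [AddCommGroup V] [Module ℂ V]
    {g : V →ₗ[ℂ] V →ₗ[ℂ] ℂ} (hg : ∀ v : V, (∀ w : V, g v w = 0) → v = 0)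
    {u v : V} (hu : u ≠ 0) (h : ∀ a b : V, g u a * g v b = g u b * g v a) :
    ∃ lam : ℂ, v = lam • u := by
  obtain ⟨a, ha⟩ : ∃ a, g u a ≠ 0 := by
    by_contra! h0
    exact hu (hg u h0)
  refine ⟨g v a / g u a, sub_eq_zero.1 (hg _ fun b => ?_)⟩
  simp only [map_sub, map_smul, LinearMap.sub_apply, LinearMap.smul_apply, smul_eq_mul]
  field_simp
  linear_combination h a b

/-- An endomorphism with a finite spanning set of eigenvectors decomposes the space into
eigenspaces with distinct eigenvalues. -/
theorem exists_eigenspace_decomposition {V : Type*} [AddCommGroup V] [Module ℂ V]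
    (f : Module.End ℂ V) {A : Finset V} (hA0 : ∀ α ∈ A, α ≠ 0)
    (hspan : Submodule.span ℂ (A : Set V) = ⊤) (hf : ∀ α ∈ A, ∃ lam : ℂ, f α = lam • α) :
    ∃ (k : ℕ) (Vs : Fin k → Submodule ℂ V) (lam : Fin k → ℂ),
      Function.Injective lam ∧ (∀ i, Vs i ≠ ⊥) ∧ iSupIndep Vs ∧ (⨆ i, Vs i) = ⊤ ∧
      ∀ i, ∀ v ∈ Vs i, f v = lam i • v := by
  classical
  choose! l hl using hf
  let e := (A.image l).equivFin
  let lam : Fin (A.image l).card → ℂ := fun i => (e.symm i : ℂ)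
  have hinj : Function.Injective lam := Subtype.val_injective.comp e.symm.injective
  refine ⟨_, fun i => f.eigenspace (lam i), lam, hinj, fun i => ?_,
    f.eigenspaces_iSupIndep.comp hinj, ?_, fun i v hv => Module.End.mem_eigenspace_iff.1 hv⟩
  · obtain ⟨α, hα, h⟩ := Finset.mem_image.1 (e.symm i).2
    refine (Submodule.ne_bot_iff _).2 ⟨α, Module.End.mem_eigenspace_iff.2 ?_, hA0 α hα⟩
    rw [hl α hα, h]
  · rw [eq_top_iff, ← hspan, Submodule.span_le]
    intro α hα
    refine Submodule.mem_iSup_of_mem (e ⟨l α, Finset.mem_image_of_mem l hα⟩)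
      (Module.End.mem_eigenspace_iff.2 ?_)
    simp only [lam, Equiv.symm_apply_apply]
    exact hl α hα

/-- for a Euclidean trigonometric ∨-system spanning `V`, the
operator `M = Σ_{β∈A} c_β β⊗β` has every `α ∈ A` as an eigenvector, and `V`
decomposes as a direct sum of eigenspaces of `M` with pairwise distinct
eigenvalues. -/
theorem stmt5 {V : Type*} [AddCommGroup V] [Module ℂ V]
    (g : V →ₗ[ℂ] V →ₗ[ℂ] ℂ)
    (hgsymm : ∀ u v : V, g u v = g v u)
    (hgnondeg : ∀ v : V, (∀ w : V, g v w = 0) → v = 0)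
    (A : Finset V) (hA0 : ∀ α ∈ A, α ≠ 0) (c : V → ℂ)
    (hA : IsEuclidTrigVSystem (fun u v => g u v) A c)
    (hspan : Submodule.span ℂ (A : Set V) = ⊤)
    (M : V → V) (hM : ∀ u : V, M u = ∑ β ∈ A, (c β * g β u) • β) :
    (∀ α ∈ A, ∃ lam : ℂ, M α = lam • α) ∧
    (∃ (k : ℕ) (Vs : Fin k → Submodule ℂ V) (lam : Fin k → ℂ),
      Function.Injective lam ∧
      (∀ i, Vs i ≠ ⊥) ∧
      iSupIndep Vs ∧
      (⨆ i, Vs i) = ⊤ ∧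
      ∀ i, ∀ v ∈ Vs i, M v = lam i • v) := by
  have heig : ∀ α ∈ A, ∃ lam : ℂ, M α = lam • α := by
    intro α hα
    refine exists_eq_smul_of_wedge_eq_zero hgnondeg (hA0 α hα) fun a b => sub_eq_zero.1 ?_
    rw [← hA.sum_eq_zero hα a b, hM]
    simp only [map_sum, map_smul, LinearMap.sum_apply, LinearMap.smul_apply, smul_eq_mul,
      Finset.mul_sum, ← Finset.sum_sub_distrib]
    refine Finset.sum_congr rfl fun β _ => ?_
    rw [hgsymm β α]
    ring
  let f : Module.End ℂ V := ∑ β ∈ A, (g β).smulRight (c β • β)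
  have hf : ∀ u, f u = M u := fun u => by
    simp [f, hM, LinearMap.sum_apply, smul_smul, mul_comm]
  refine ⟨heig, ?_⟩
  simp only [← hf] at heig ⊢
  exact exists_eigenspace_decomposition f hA0 hspan heig
end

section
/- Let A ⊂ V = ℂ^N be a finite set of nonzero vectors with multiplicities c_α such that the prepotential F(x) = Σ_{α∈A} c_α f((α,x)) (with f'''(z) = cot z) satisfies the commutativity equations F_i F_j = F_j F_i. Let B = A ∩ W be a subsystem with W = ⟨B⟩ of dimension N − n, and suppose the restriction of (·,·) to W_B = {x ∈ V : (β,x) = 0 for all β ∈ B} is non-degenerate. Suppose further that C_δ^{α₀} ≠ 0 for every α in a basis S ⊂ B of W, every α₀ ∈ δ_α and every δ ⊆ δ_α. Fix an orthonormal basis f₁,…,f_n of W_B with coordinates ξ = (ξ^1,…,ξ^n). Then the restricted prepotential F_B(ξ) = Σ_{α∈A∖B} c_α f((α,ξ)), defined on M_B = W_B ∖ ∪_{α∈A∖B}{(α,·)=0}, satisfies the commutativity equations (F_B)_i (F_B)_j = (F_B)_j (F_B)_i for i,j = 1,…,n, where ((F_B)_i)_{pq} = ∂³F_B/∂ξ^i∂ξ^p∂ξ^q.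 -/
open scoped BigOperators

/-- The matrix `F_i` of third derivatives of the trigonometric prepotential
`F = Σ_{α∈A} c_α f((α,x))`, `f''' = cot`:
`(F_i)_{pq} = Σ_{α∈A} c_α α_i α_p α_q cot((α,x))`. -/
noncomputable def Tmat {N : ℕ} (A : Finset (Fin N → ℂ)) (c : (Fin N → ℂ) → ℂ)
    (x : Fin N → ℂ) (i : Fin N) : Matrix (Fin N) (Fin N) ℂ :=
  Matrix.of fun p q => ∑ α ∈ A, c α * α i * α p * α q * ccot (dotc α x)

open Filter Topology in
/-- If `φ → 0` through nonzero values and `s / φ → L`, then `s * cot φ → L`. -/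
lemma tendsto_mul_ccot {ι : Type*} {l : Filter ι} {φ s : ι → ℂ} {L : ℂ}
    (hφ : Tendsto φ l (𝓝[≠] 0)) (hs : Tendsto (fun t => s t / φ t) l (𝓝 L)) :
    Tendsto (fun t => s t * ccot (φ t)) l (𝓝 L) := by
  have hsin : Tendsto (fun z : ℂ => z⁻¹ * Complex.sin z) (𝓝[≠] 0) (𝓝 1) := by
    simpa using (Complex.hasDerivAt_sin 0).tendsto_slope_zero
  have hcos : Tendsto Complex.cos (𝓝[≠] 0) (𝓝 1) := by
    simpa using Complex.continuous_cos.continuousAt.tendsto.mono_left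
      (nhdsWithin_le_nhds (a := (0 : ℂ)) (s := {0}ᶜ))
  have hlim := (hs.mul (hcos.comp hφ)).div (hsin.comp hφ) one_ne_zero
  rw [mul_one, div_one] at hlim
  refine hlim.congr' ?_
  have hne : ∀ᶠ t in l, φ t ≠ 0 := hφ.eventually self_mem_nhdsWithin
  filter_upwards [hne] with t ht
  simp only [Pi.div_apply, Function.comp_apply, ccot]
  rw [div_mul_eq_mul_div, div_div, mul_inv_cancel_left₀ ht, mul_div_assoc]

lemma continuousAt_ccot {z : ℂ} (hz : Complex.sin z ≠ 0) : ContinuousAt ccot z :=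
  Complex.continuous_cos.continuousAt.div Complex.continuous_sin.continuousAt hz

lemma eventually_sin_ne_zero : ∀ᶠ z in nhdsWithin (0 : ℂ) {0}ᶜ, Complex.sin z ≠ 0 :=
  (Complex.hasDerivAt_sin 0).eventually_ne (by simp)

section Dot

variable {N : ℕ}

lemma dotc_eq_dotProduct (u v : Fin N → ℂ) : dotc u v = dotProduct u v := rfl

lemma dotc_comm (u v : Fin N → ℂ) : dotc u v = dotc v u := dotProduct_comm u v

lemma dotc_smul_left (a : ℂ) (u v : Fin N → ℂ) : dotc (a • u) v = a * dotc u v :=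
  smul_dotProduct a u v

lemma dotc_sum_right {ι : Type*} (s : Finset ι) (u : Fin N → ℂ) (v : ι → Fin N → ℂ) :
    dotc u (∑ i ∈ s, v i) = ∑ i ∈ s, dotc u (v i) :=
  dotProduct_sum u s v

lemma dotc_smul_right (a : ℂ) (u v : Fin N → ℂ) : dotc u (a • v) = a * dotc u v :=
  dotProduct_smul a u v

/-- The functional `(γ, ·)`. -/
noncomputable def dotcDual (γ : Fin N → ℂ) : Module.Dual ℂ (Fin N → ℂ) :=
  dotProductBilin ℂ ℂ γ

lemma dotcDual_apply (γ y : Fin N → ℂ) : dotcDual γ y = dotc γ y := rfl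

lemma exists_dotc_ne_zero {γ : Fin N → ℂ} (hγ : γ ≠ 0) : ∃ z, dotc γ z ≠ 0 := by
  obtain ⟨k, hk⟩ := Function.ne_iff.mp hγ
  exact ⟨Pi.single k 1, by simpa [dotc_eq_dotProduct] using hk⟩

lemma exists_dotc_eq_zero_ne_zero {β γ : Fin N → ℂ} (h : ¬ Collin β γ) :
    ∃ y, dotc β y = 0 ∧ dotc γ y ≠ 0 := by
  by_cases hβ : β = 0
  · subst hβ
    obtain ⟨y, hy⟩ := exists_dotc_ne_zero (γ := γ) fun h0 => h ⟨0, by simp [h0]⟩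
    exact ⟨y, by simp [dotc_eq_dotProduct], hy⟩
  · obtain ⟨k, hk⟩ := Function.ne_iff.mp hβ
    by_contra! hall
    refine h ⟨γ k / β k, funext fun j => ?_⟩
    have := hall (Pi.single j (β k) - Pi.single k (β j))
      (by simp [dotc_eq_dotProduct, dotProduct_sub, mul_comm])
    simp only [dotc_eq_dotProduct, dotProduct_sub, dotProduct_single] at this
    simp only [Pi.smul_apply, smul_eq_mul]
    rw [div_mul_eq_mul_div, eq_div_iff hk, sub_eq_zero.mp this]

/-- A vector orthogonal to `β` and to no element of `A` outside the line of `β`. -/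
lemma exists_generic_dotc (A : Finset (Fin N → ℂ)) (β : Fin N → ℂ) :
    ∃ y, dotc β y = 0 ∧ ∀ γ ∈ A, ¬ Collin β γ → dotc γ y ≠ 0 := by
  obtain ⟨y, hy, hne⟩ := Module.Dual.exists_forall_mem_ne_zero_of_forall_exists
    (LinearMap.ker (dotcDual β)) (fun γ : {γ : A // ¬ Collin β γ.1} => dotcDual γ.1.1)
    fun γ => exists_dotc_eq_zero_ne_zero γ.2
  exact ⟨y, hy, fun γ hγ hc => hne ⟨⟨γ, hγ⟩, hc⟩⟩

end Dot

section Prepotential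

variable {N : ℕ}

/-- The product `u * v = Σ_{α ∈ A} c_α g_α (α,u) (α,v) α`. -/
noncomputable def prepotentialMul (A : Finset (Fin N → ℂ)) (c g : (Fin N → ℂ) → ℂ)
    (u v : Fin N → ℂ) : Fin N → ℂ :=
  ∑ α ∈ A, (c α * g α * dotc α u * dotc α v) • α

variable {A B AB : Finset (Fin N → ℂ)} {c g : (Fin N → ℂ) → ℂ}

lemma prepotentialMul_comm (u v : Fin N → ℂ) :
    prepotentialMul A c g u v = prepotentialMul A c g v u :=
  Finset.sum_congr rfl fun α _ => by rw [mul_right_comm]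

lemma smul_prepotentialMul (a : ℂ) (u v : Fin N → ℂ) :
    a • prepotentialMul A c g u v = prepotentialMul A c (fun α => a * g α) u v := by
  simp only [prepotentialMul, Finset.smul_sum, smul_smul]
  exact Finset.sum_congr rfl fun α _ => by ring_nf

lemma dotc_prepotentialMul (y u v : Fin N → ℂ) :
    dotc y (prepotentialMul A c g u v) = ∑ α ∈ A, c α * g α * dotc α u * dotc α v * dotc α y := by
  simp only [prepotentialMul, dotc_sum_right, dotc_smul_right]
  exact Finset.sum_congr rfl fun α _ => by rw [dotc_comm y]

/-- Vectors orthogonal to a subsystem do not see it in the product. -/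
lemma prepotentialMul_eq_of_orthogonal (hAB : ∀ v, v ∈ AB ↔ v ∈ A ∧ v ∉ B)
    {u : Fin N → ℂ} (hu : ∀ β ∈ B, dotc β u = 0) (v : Fin N → ℂ) :
    prepotentialMul A c g u v = prepotentialMul AB c g u v := by
  refine (Finset.sum_subset (fun α hα => ((hAB α).1 hα).1) fun α hα hα' => ?_).symm
  have hαB : α ∈ B := by
    by_contra h
    exact hα' ((hAB α).2 ⟨hα, h⟩)
  simp [hu α hαB]

open Filter Topology in
lemma tendsto_prepotentialMul {ι : Type*} {l : Filter ι} {G : ι → (Fin N → ℂ) → ℂ}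
    (hG : ∀ α ∈ A, Tendsto (fun t => G t α) l (𝓝 (g α))) (u : Fin N → ℂ)
    {v : ι → Fin N → ℂ} {v₀ : Fin N → ℂ} (hv : Tendsto v l (𝓝 v₀)) :
    Tendsto (fun t => prepotentialMul A c (G t) u (v t)) l
      (𝓝 (prepotentialMul A c g u v₀)) := by
  refine tendsto_finsetSum _ fun α hα => Tendsto.smul ?_ tendsto_const_nhds
  refine ((tendsto_const_nhds.mul (hG α hα)).mul tendsto_const_nhds).mul ?_
  have hcont : Continuous fun w => dotc α w := by
    unfold dotc
    fun_prop
  exact (hcont.tendsto v₀).comp hv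

lemma sum_smul_Tmat_mulVec (x u v : Fin N → ℂ) :
    (∑ i, u i • Tmat A c x i).mulVec v =
      prepotentialMul A c (fun α => ccot (dotc α x)) u v := by
  ext p
  simp only [Matrix.mulVec, dotProduct, Matrix.sum_apply, Matrix.smul_apply, Tmat,
    Matrix.of_apply, smul_eq_mul, prepotentialMul, Finset.sum_apply, Pi.smul_apply, dotc]
  simp only [Finset.mul_sum, Finset.sum_mul]
  rw [Finset.sum_comm_cycle]
  refine Finset.sum_congr rfl fun α _ => ?_
  refine Finset.sum_congr rfl fun i _ => Finset.sum_congr rfl fun q _ => ?_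
  ring

/-- The commutativity equations as an identity for the product. -/
lemma prepotentialMul_left_comm {x : Fin N → ℂ}
    (h : ∀ i j, Tmat A c x i * Tmat A c x j = Tmat A c x j * Tmat A c x i)
    (u v w : Fin N → ℂ) :
    prepotentialMul A c (fun α => ccot (dotc α x)) u
        (prepotentialMul A c (fun α => ccot (dotc α x)) v w) =
      prepotentialMul A c (fun α => ccot (dotc α x)) v
        (prepotentialMul A c (fun α => ccot (dotc α x)) u w) := by
  have hc : Commute (∑ i, u i • Tmat A c x i) (∑ j, v j • Tmat A c x j) :=
    Commute.sum_left _ _ _ fun i _ => Commute.sum_right _ _ _ fun j _ =>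
      ((show Commute (Tmat A c x i) (Tmat A c x j) from h i j).smul_left (u i)).smul_right (v j)
  simp only [← sum_smul_Tmat_mulVec, Matrix.mulVec_mulVec]
  rw [hc.eq]

end Prepotential

section Approach

open Filter Topology

variable {N : ℕ}

/-- A curve through `x₀` with velocity `y` and acceleration `2 z`. -/
def quadCurve (x₀ y z : Fin N → ℂ) (t : ℂ) : Fin N → ℂ := x₀ + t • (y + t • z)

lemma dotc_quadCurve (α x₀ y z : Fin N → ℂ) (t : ℂ) :
    dotc α (quadCurve x₀ y z t) = dotc α x₀ + t * (dotc α y + t * dotc α z) := by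
  simp [dotc_eq_dotProduct, quadCurve, dotProduct_add, dotProduct_smul, mul_add]

lemma tendsto_dotc_quadCurve (α x₀ y z : Fin N → ℂ) :
    Tendsto (fun t => dotc α (quadCurve x₀ y z t)) (𝓝[≠] 0) (𝓝 (dotc α x₀)) := by
  simp only [dotc_quadCurve]
  have : Continuous fun t : ℂ => dotc α x₀ + t * (dotc α y + t * dotc α z) := by fun_prop
  simpa using (this.tendsto 0).mono_left nhdsWithin_le_nhds

lemma tendsto_ccot_quadCurve {α x₀ : Fin N → ℂ} (h : Complex.sin (dotc α x₀) ≠ 0)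
    (y z : Fin N → ℂ) :
    Tendsto (fun t => ccot (dotc α (quadCurve x₀ y z t))) (𝓝[≠] 0) (𝓝 (ccot (dotc α x₀))) :=
  (continuousAt_ccot h).tendsto.comp (tendsto_dotc_quadCurve α x₀ y z)

lemma tendsto_sq_nhdsNE : Tendsto (fun t : ℂ => t ^ 2) (𝓝[≠] 0) (𝓝 0) := by
  simpa using ((continuous_pow 2).tendsto (0 : ℂ)).mono_left nhdsWithin_le_nhds

lemma tendsto_velocity {α y : Fin N → ℂ} (z : Fin N → ℂ) :
    Tendsto (fun t => dotc α y + t * dotc α z) (𝓝[≠] 0) (𝓝 (dotc α y)) := by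
  have : Continuous fun t : ℂ => dotc α y + t * dotc α z := by fun_prop
  simpa using (this.tendsto 0).mono_left nhdsWithin_le_nhds

/-- `(α, ·)` vanishes along the curve only at `t = 0`, locally. -/
lemma tendsto_dotc_quadCurve_nhdsNE {α x₀ y z : Fin N → ℂ} (h0 : dotc α x₀ = 0)
    (h : dotc α y ≠ 0 ∨ dotc α y = 0 ∧ dotc α z ≠ 0) :
    Tendsto (fun t => dotc α (quadCurve x₀ y z t)) (𝓝[≠] 0) (𝓝[≠] 0) := by
  refine tendsto_nhdsWithin_iff.2 ⟨h0 ▸ tendsto_dotc_quadCurve α x₀ y z, ?_⟩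
  simp only [dotc_quadCurve, h0, zero_add, Set.mem_compl_iff, Set.mem_singleton_iff]
  have hne : ∀ᶠ t : ℂ in 𝓝[≠] 0, t ≠ 0 := self_mem_nhdsWithin
  rcases h with hy | ⟨hy, hz⟩
  · filter_upwards [hne, (tendsto_velocity z).eventually_ne hy] with t ht hv
    exact mul_ne_zero ht hv
  · filter_upwards [hne] with t ht
    simp [hy, hz, ht]

lemma eventually_sin_quadCurve_ne_zero {α x₀ y z : Fin N → ℂ}
    (h : Complex.sin (dotc α x₀) ≠ 0 ∨
      dotc α x₀ = 0 ∧ (dotc α y ≠ 0 ∨ dotc α y = 0 ∧ dotc α z ≠ 0)) :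
    ∀ᶠ t in 𝓝[≠] 0, Complex.sin (dotc α (quadCurve x₀ y z t)) ≠ 0 := by
  rcases h with h | ⟨h0, h⟩
  · exact ((Complex.continuous_sin.tendsto _).comp
      (tendsto_dotc_quadCurve α x₀ y z)).eventually_ne h
  · exact (tendsto_dotc_quadCurve_nhdsNE h0 h).eventually eventually_sin_ne_zero

lemma tendsto_sq_mul_ccot_of_velocity_ne {α x₀ y : Fin N → ℂ} (z : Fin N → ℂ)
    (h0 : dotc α x₀ = 0) (hy : dotc α y ≠ 0) :
    Tendsto (fun t => t ^ 2 * ccot (dotc α (quadCurve x₀ y z t))) (𝓝[≠] 0) (𝓝 0) := by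
  refine tendsto_mul_ccot (tendsto_dotc_quadCurve_nhdsNE h0 (Or.inl hy)) ?_
  have hid : Tendsto (fun t : ℂ => t) (𝓝[≠] 0) (𝓝 0) := tendsto_id.mono_left nhdsWithin_le_nhds
  have hlim := hid.div (tendsto_velocity z) hy
  rw [zero_div] at hlim
  refine hlim.congr' ?_
  have hne : ∀ᶠ t : ℂ in 𝓝[≠] 0, t ≠ 0 := self_mem_nhdsWithin
  filter_upwards [hne] with t ht
  rw [dotc_quadCurve, h0, zero_add, sq, mul_div_mul_left _ _ ht, Pi.div_apply]

lemma tendsto_sq_mul_ccot_of_velocity_eq {α x₀ y z : Fin N → ℂ}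
    (h0 : dotc α x₀ = 0) (hy : dotc α y = 0) (hz : dotc α z ≠ 0) :
    Tendsto (fun t => t ^ 2 * ccot (dotc α (quadCurve x₀ y z t))) (𝓝[≠] 0)
      (𝓝 (dotc α z)⁻¹) := by
  refine tendsto_mul_ccot (tendsto_dotc_quadCurve_nhdsNE h0 (Or.inr ⟨hy, hz⟩)) ?_
  refine tendsto_const_nhds.congr' ?_
  have hne : ∀ᶠ t : ℂ in 𝓝[≠] 0, t ≠ 0 := self_mem_nhdsWithin
  filter_upwards [hne] with t ht
  rw [dotc_quadCurve, h0, hy, zero_add, zero_add]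
  field_simp

end Approach

section Restriction

open Filter Topology

variable {N : ℕ} {A B AB : Finset (Fin N → ℂ)} {c : (Fin N → ℂ) → ℂ} {x₀ : Fin N → ℂ}

/-- The commutativity equations pass to the limit on the orthogonal complement of a subsystem. -/
lemma prepotentialMul_left_comm_restrict (hA0 : ∀ α ∈ A, α ≠ 0)
    (hcomm : ∀ x, (∀ α ∈ A, Complex.sin (dotc α x) ≠ 0) →
      ∀ i j : Fin N, Tmat A c x i * Tmat A c x j = Tmat A c x j * Tmat A c x i)
    (hAB : ∀ v, v ∈ AB ↔ v ∈ A ∧ v ∉ B)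
    (hx₀ : ∀ β ∈ B, dotc β x₀ = 0) (hreg : ∀ α ∈ AB, Complex.sin (dotc α x₀) ≠ 0)
    {u v : Fin N → ℂ} (hu : ∀ β ∈ B, dotc β u = 0) (hv : ∀ β ∈ B, dotc β v = 0)
    (w : Fin N → ℂ) :
    prepotentialMul AB c (fun α => ccot (dotc α x₀)) u
        (prepotentialMul AB c (fun α => ccot (dotc α x₀)) v w) =
      prepotentialMul AB c (fun α => ccot (dotc α x₀)) v
        (prepotentialMul AB c (fun α => ccot (dotc α x₀)) u w) := by
  obtain ⟨y, -, hy⟩ := exists_generic_dotc A 0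
  have hcot : ∀ α ∈ AB, Tendsto (fun t => ccot (dotc α (quadCurve x₀ y 0 t))) (𝓝[≠] 0)
      (𝓝 (ccot (dotc α x₀))) := fun α hα => tendsto_ccot_quadCurve (hreg α hα) y 0
  have hlim : ∀ a b, Tendsto (fun t => prepotentialMul AB c
      (fun α => ccot (dotc α (quadCurve x₀ y 0 t))) a (prepotentialMul AB c
        (fun α => ccot (dotc α (quadCurve x₀ y 0 t))) b w)) (𝓝[≠] 0) _ := fun a b =>
    tendsto_prepotentialMul hcot a (tendsto_prepotentialMul hcot b tendsto_const_nhds)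
  refine tendsto_nhds_unique_of_eventuallyEq (hlim u v) (hlim v u) ?_
  have hsin : ∀ᶠ t in 𝓝[≠] 0, ∀ α ∈ A, Complex.sin (dotc α (quadCurve x₀ y 0 t)) ≠ 0 := by
    refine (Finset.eventually_all A).2 fun α hα => eventually_sin_quadCurve_ne_zero ?_
    by_cases hαB : α ∈ B
    · exact Or.inr ⟨hx₀ α hαB, Or.inl (hy α hα fun ⟨k, hk⟩ => hA0 α hα (by simpa using hk))⟩
    · exact Or.inl (hreg α ((hAB α).2 ⟨hα, hαB⟩))
  filter_upwards [hsin] with t ht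
  simpa only [prepotentialMul_eq_of_orthogonal hAB hu, prepotentialMul_eq_of_orthogonal hAB hv]
    using prepotentialMul_left_comm (hcomm _ ht) u v w

/-- The product of two vectors orthogonal to a subsystem `B` is orthogonal to each `β ∈ B` with
`C_{δ_β}^β ≠ 0`. -/
lemma dotc_prepotentialMul_eq_zero (hA0 : ∀ α ∈ A, α ≠ 0)
    (hcomm : ∀ x, (∀ α ∈ A, Complex.sin (dotc α x) ≠ 0) →
      ∀ i j : Fin N, Tmat A c x i * Tmat A c x j = Tmat A c x j * Tmat A c x i)
    (hAB : ∀ v, v ∈ AB ↔ v ∈ A ∧ v ∉ B)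
    (hx₀ : ∀ β ∈ B, dotc β x₀ = 0) (hreg : ∀ α ∈ AB, Complex.sin (dotc α x₀) ≠ 0)
    {u w : Fin N → ℂ} (hu : ∀ β ∈ B, dotc β u = 0) (hw : ∀ β ∈ B, dotc β w = 0)
    {β : Fin N → ℂ} (hβ : β ≠ 0) (hβB : ∀ α ∈ A, Collin β α → α ∈ B)
    {δ : Finset (Fin N → ℂ)} (hδ : ∀ γ, γ ∈ δ ↔ γ ∈ A ∧ Collin β γ)
    {k : (Fin N → ℂ) → ℂ} (hk : ∀ γ ∈ δ, γ = k γ • β)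
    (hC : ∑ γ ∈ δ, c γ * (k γ) ^ 2 ≠ 0) :
    dotc β (prepotentialMul AB c (fun α => ccot (dotc α x₀)) u w) = 0 := by
  classical
  obtain ⟨y, hβy, hy⟩ := exists_generic_dotc A β
  obtain ⟨z, hβz⟩ := exists_dotc_ne_zero hβ
  set P := prepotentialMul AB c (fun α => ccot (dotc α x₀)) u w with hP
  have hcol : ∀ γ ∈ δ, dotc γ y = 0 ∧ dotc γ z ≠ 0 := fun γ hγ => by
    have hγ0 := hA0 γ ((hδ γ).1 hγ).1
    have hkγ : k γ ≠ 0 := fun h0 => hγ0 (by rw [hk γ hγ, h0, zero_smul])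
    rw [hk γ hγ, dotc_smul_left, dotc_smul_left, hβy, mul_zero]
    exact ⟨rfl, mul_ne_zero hkγ hβz⟩
  have hvel : ∀ γ ∈ A, γ ∉ δ → dotc γ y ≠ 0 := fun γ hγ hγδ =>
    hy γ hγ fun hc => hγδ ((hδ γ).2 ⟨hγ, hc⟩)
  have hcot : ∀ α ∈ AB, Tendsto (fun t => ccot (dotc α (quadCurve x₀ y z t))) (𝓝[≠] 0)
      (𝓝 (ccot (dotc α x₀))) := fun α hα => tendsto_ccot_quadCurve (hreg α hα) y z
  have hsin : ∀ᶠ t in 𝓝[≠] 0, ∀ α ∈ A, Complex.sin (dotc α (quadCurve x₀ y z t)) ≠ 0 := by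
    refine (Finset.eventually_all A).2 fun α hα => eventually_sin_quadCurve_ne_zero ?_
    by_cases hαB : α ∈ B
    · refine Or.inr ⟨hx₀ α hαB, ?_⟩
      by_cases hαδ : α ∈ δ
      · exact Or.inr (hcol α hαδ)
      · exact Or.inl (hvel α hα hαδ)
    · exact Or.inl (hreg α ((hAB α).2 ⟨hα, hαB⟩))
  have hpole : ∀ α ∈ A, Tendsto (fun t => t ^ 2 * ccot (dotc α (quadCurve x₀ y z t))) (𝓝[≠] 0)
      (𝓝 (if α ∈ δ then (dotc α z)⁻¹ else 0)) := fun α hα => by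
    by_cases hαδ : α ∈ δ
    · have hαB := hβB α hα ((hδ α).1 hαδ).2
      rw [if_pos hαδ]
      exact tendsto_sq_mul_ccot_of_velocity_eq (hx₀ α hαB) (hcol α hαδ).1 (hcol α hαδ).2
    · rw [if_neg hαδ]
      by_cases hαB : α ∈ B
      · exact tendsto_sq_mul_ccot_of_velocity_ne z (hx₀ α hαB) (hvel α hα hαδ)
      · simpa using tendsto_sq_nhdsNE.mul (hcot α ((hAB α).2 ⟨hα, hαB⟩))
  have hleft : Tendsto (fun t : ℂ => t ^ 2 • prepotentialMul AB c
      (fun α => ccot (dotc α (quadCurve x₀ y z t))) u (prepotentialMul AB c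
        (fun α => ccot (dotc α (quadCurve x₀ y z t))) w z)) (𝓝[≠] 0) (𝓝 0) := by
    simpa using tendsto_sq_nhdsNE.smul
      (tendsto_prepotentialMul (c := c) hcot u
        (tendsto_prepotentialMul (c := c) hcot w (tendsto_const_nhds (x := z))))
  have hright := tendsto_prepotentialMul (c := c) hpole z
    (tendsto_prepotentialMul (c := c) hcot u (tendsto_const_nhds (x := w)))
  have hzero := tendsto_nhds_unique_of_eventuallyEq hright hleft <| by
    filter_upwards [hsin] with t ht
    have hlc := prepotentialMul_left_comm (hcomm _ ht) u z w
    rw [prepotentialMul_comm z w] at hlc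
    simp only [prepotentialMul_eq_of_orthogonal hAB hu,
      prepotentialMul_eq_of_orthogonal hAB hw] at hlc
    rw [hlc, smul_prepotentialMul]
  rw [← hP] at hzero
  have hδA : δ ⊆ A := fun γ hγ => ((hδ γ).1 hγ).1
  have hres : ((∑ γ ∈ δ, c γ * (k γ) ^ 2) * dotc β P) • β = 0 := by
    rw [← hzero, prepotentialMul, ← Finset.sum_subset hδA fun γ _ hγ => by simp [hγ],
      Finset.sum_mul, Finset.sum_smul]
    refine Finset.sum_congr rfl fun γ hγ => ?_
    rw [if_pos hγ, inv_mul_cancel_right₀ (hcol γ hγ).2]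
    have hdot : dotc γ P = k γ * dotc β P := by
      rw [← dotc_smul_left, ← hk γ hγ]
    have hsmul : ∀ a : ℂ, a • γ = (a * k γ) • β := fun a => by
      rw [mul_smul, ← hk γ hγ]
    rw [hsmul, hdot]
    ring_nf
  simpa [hβ, hC] using hres

end Restriction

/-- Expansion of the form on the span of an orthonormal family. -/
lemma sum_dotc_mul_dotc_of_mem_span {N n : ℕ} {fb : Fin n → Fin N → ℂ}
    (hfbON : ∀ i j, dotc (fb i) (fb j) = if i = j then 1 else 0) {y : Fin N → ℂ}
    (hy : y ∈ Submodule.span ℂ (Set.range fb)) (w : Fin N → ℂ) :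
    ∑ r, dotc w (fb r) * dotc y (fb r) = dotc w y := by
  obtain ⟨a, rfl⟩ := (Submodule.mem_span_range_iff_exists_fun ℂ).1 hy
  have ha : ∀ r, dotc (∑ i, a i • fb i) (fb r) = a r := fun r => by
    simp [dotc_comm _ (fb r), dotc_sum_right, dotc_smul_right, hfbON]
  simp only [ha, dotc_sum_right, dotc_smul_right, mul_comm]

/-- the restriction of a trigonometric solution of the
commutativity equations to (the complement of) a subsystem `B = A ∩ W`
again satisfies the commutativity equations.  Here `AB = A ∖ B`,
`f₁,…,f_n` is an orthonormal basis of
`W_B = {x : (β,x) = 0 ∀ β ∈ B}`, and the restricted prepotential is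
`F_B(ξ) = Σ_{α∈A∖B} c_α f((α, Σ ξ^i f_i))`. -/
theorem stmt8 {N n : ℕ} (A : Finset (Fin N → ℂ)) (hA0 : ∀ α ∈ A, α ≠ 0)
    (c : (Fin N → ℂ) → ℂ)
    -- the commutativity equations for the prepotential of `(A, c)`
    (hcomm : ∀ x, (∀ α ∈ A, Complex.sin (dotc α x) ≠ 0) →
      ∀ i j : Fin N, Tmat A c x i * Tmat A c x j = Tmat A c x j * Tmat A c x i)
    -- the subsystem `B = A ∩ W`, with `W = ⟨B⟩` of dimension `N − n`
    (W : Submodule ℂ (Fin N → ℂ)) (B : Finset (Fin N → ℂ))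
    (hB : ∀ v, v ∈ B ↔ v ∈ A ∧ v ∈ W)
    (hspanB : Submodule.span ℂ (B : Set (Fin N → ℂ)) = W)
    (hdimW : Module.finrank ℂ W = N - n) (hn : n ≤ N)
    -- `AB = A ∖ B`
    (AB : Finset (Fin N → ℂ)) (hAB : ∀ v, v ∈ AB ↔ v ∈ A ∧ v ∉ B)
    -- non-degeneracy of `(·,·)` on `W_B`
    (hWBnondeg : ∀ w : Fin N → ℂ, (∀ β ∈ B, dotc β w = 0) →
      (∀ w' : Fin N → ℂ, (∀ β ∈ B, dotc β w' = 0) → dotc w w' = 0) → w = 0)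
    -- a basis `S ⊆ B` of `W` and the conditions `C_δ^{α₀} ≠ 0` for `α ∈ S`
    (S : Finset (Fin N → ℂ)) (hSB : ∀ v ∈ S, v ∈ B)
    (hSind : LinearIndependent ℂ ((↑) : ↥(S : Set (Fin N → ℂ)) → (Fin N → ℂ)))
    (hSspan : Submodule.span ℂ (S : Set (Fin N → ℂ)) = W)
    (hC : ∀ α ∈ S, ∀ α₀ ∈ A, Collin α α₀ →
      ∀ δ : Finset (Fin N → ℂ), δ.Nonempty → (∀ γ ∈ δ, γ ∈ A ∧ Collin α γ) →
      ∀ k : (Fin N → ℂ) → ℂ, (∀ γ ∈ δ, γ = k γ • α₀) →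
        ∑ γ ∈ δ, c γ * (k γ) ^ 2 ≠ 0)
    -- an orthonormal basis `f₁,…,f_n` of `W_B`
    (fb : Fin n → (Fin N → ℂ))
    (hfbWB : ∀ i, ∀ β ∈ B, dotc β (fb i) = 0)
    (hfbON : ∀ i j, dotc (fb i) (fb j) = if i = j then 1 else 0)
    (hfbspan : ∀ w : Fin N → ℂ, (∀ β ∈ B, dotc β w = 0) →
      w ∈ Submodule.span ℂ (Set.range fb)) :
    -- the commutativity equations for the restricted prepotential `F_B`
    ∀ ξ : Fin n → ℂ,
      (∀ α ∈ AB, Complex.sin (dotc α (∑ i, ξ i • fb i)) ≠ 0) →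
      ∀ i j : Fin n,
        (Matrix.of fun p q : Fin n => ∑ α ∈ AB,
            c α * dotc α (fb i) * dotc α (fb p) * dotc α (fb q) *
              ccot (dotc α (∑ l, ξ l • fb l))) *
        (Matrix.of fun p q : Fin n => ∑ α ∈ AB,
            c α * dotc α (fb j) * dotc α (fb p) * dotc α (fb q) *
              ccot (dotc α (∑ l, ξ l • fb l))) =
        (Matrix.of fun p q : Fin n => ∑ α ∈ AB,
            c α * dotc α (fb j) * dotc α (fb p) * dotc α (fb q) *
              ccot (dotc α (∑ l, ξ l • fb l))) *
        (Matrix.of fun p q : Fin n => ∑ α ∈ AB,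
            c α * dotc α (fb i) * dotc α (fb p) * dotc α (fb q) *
              ccot (dotc α (∑ l, ξ l • fb l))) := by
  intro ξ hξ i j
  classical
  set x₀ := ∑ l, ξ l • fb l with hx₀def
  have hx₀ : ∀ β ∈ B, dotc β x₀ = 0 := fun β hβ => by
    simp [hx₀def, dotc_sum_right, dotc_smul_right, hfbWB _ β hβ]
  have hmem : ∀ a b, prepotentialMul AB c (fun α => ccot (dotc α x₀)) (fb a) (fb b) ∈
      Submodule.span ℂ (Set.range fb) := fun a b => by
    refine hfbspan _ fun β hβ => ?_
    have hle : W ≤ LinearMap.ker (dotcDual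
        (prepotentialMul AB c (fun α => ccot (dotc α x₀)) (fb a) (fb b))) := by
      rw [← hSspan, Submodule.span_le]
      intro σ hσ
      have hσB := (hB σ).1 (hSB σ hσ)
      choose! k hk using fun γ (h : Collin σ γ) => h
      have hδ : ∀ γ, γ ∈ A.filter (Collin σ) ↔ γ ∈ A ∧ Collin σ γ := fun γ => Finset.mem_filter
      have hkδ : ∀ γ ∈ A.filter (Collin σ), γ = k γ • σ := fun γ hγ => hk γ ((hδ γ).1 hγ).2
      have hσσ : Collin σ σ := ⟨1, (one_smul ℂ σ).symm⟩
      rw [SetLike.mem_coe, LinearMap.mem_ker, dotcDual_apply, dotc_comm]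
      refine dotc_prepotentialMul_eq_zero hA0 hcomm hAB hx₀ hξ (hfbWB a) (hfbWB b)
        (hA0 σ hσB.1) (fun α hα ⟨s, hs⟩ => (hB α).2 ⟨hα, hs ▸ W.smul_mem s hσB.2⟩) hδ hkδ ?_
      exact hC σ hσ σ hσB.1 hσσ _ ⟨σ, (hδ σ).2 ⟨hσB.1, hσσ⟩⟩ (fun γ => (hδ γ).1) k hkδ
    rw [dotc_comm]
    exact hle ((hB β).1 hβ).2
  have hentry : ∀ a p q, ∑ α ∈ AB, c α * dotc α (fb a) * dotc α (fb p) * dotc α (fb q) *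
      ccot (dotc α x₀) = dotc (prepotentialMul AB c (fun α => ccot (dotc α x₀)) (fb a) (fb p))
        (fb q) := fun a p q => by
    rw [dotc_comm, dotc_prepotentialMul]
    exact Finset.sum_congr rfl fun α _ => by ring
  have hswap : ∀ a p w, dotc (prepotentialMul AB c (fun α => ccot (dotc α x₀)) (fb a) (fb p)) w =
      dotc (fb p) (prepotentialMul AB c (fun α => ccot (dotc α x₀)) (fb a) w) := fun a p w => by
    rw [dotc_comm, dotc_prepotentialMul, dotc_prepotentialMul]
    exact Finset.sum_congr rfl fun α _ => by ring
  have hprod : ∀ a b p q,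
      ∑ r, (∑ α ∈ AB, c α * dotc α (fb a) * dotc α (fb p) * dotc α (fb r) * ccot (dotc α x₀)) *
        (∑ α ∈ AB, c α * dotc α (fb b) * dotc α (fb r) * dotc α (fb q) * ccot (dotc α x₀)) =
      dotc (fb p) (prepotentialMul AB c (fun α => ccot (dotc α x₀)) (fb a)
        (prepotentialMul AB c (fun α => ccot (dotc α x₀)) (fb b) (fb q))) := fun a b p q => by
    rw [← hswap, ← sum_dotc_mul_dotc_of_mem_span hfbON (hmem b q)]
    refine Finset.sum_congr rfl fun r _ => ?_
    rw [hentry, hentry, hswap b r, dotc_comm (fb r), prepotentialMul_comm (fb b) (fb q)]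
  ext p q
  simp only [Matrix.mul_apply, Matrix.of_apply]
  rw [hprod, hprod, prepotentialMul_left_comm_restrict hA0 hcomm hAB hx₀ hξ (hfbWB i) (hfbWB j)]
end

section
/- Let F = F(x^1,…,x^N) satisfy the commutativity equations F_i F_j = F_j F_i for all i,j, fix i₀ ∈ {1,…,N}, and let a,b,c ∈ {1,…,N} and r,t ∈ {1,…,N} with r < t and r,t ≠ i₀. Then det [[F_{a i₀ r}, F_{b i₀ r}, F_{c i₀ r}], [F_{a i₀ t}, F_{b i₀ t}, F_{c i₀ t}], [F_{a r t}, F_{b r t}, F_{c r t}]] = − Σ_{m=1,…,N, m≠t} det [[F_{a i₀ r}, F_{b i₀ r}, F_{c i₀ r}], [F_{a i₀ m}, F_{b i₀ m}, F_{c i₀ m}], [F_{a r m}, F_{b r m}, F_{c r m}]]. -/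
open scoped BigOperators

/-- Partial derivatives of a holomorphic function commute. -/
theorem pd_comm {N : ℕ} {F : (Fin N → ℂ) → ℂ} (hF : ContDiff ℂ ⊤ F) (p q : Fin N) :
    pd p (pd q F) = pd q (pd p F) := by
  have pd_pd (i j : Fin N) (y : Fin N → ℂ) :
      pd i (pd j F) y = fderiv ℂ (fderiv ℂ F) y (Pi.single i 1) (Pi.single j 1) := by
    have hd : DifferentiableAt ℂ (fderiv ℂ F) y :=
      ((hF.fderiv_right (m := 1) le_top).differentiable one_ne_zero) y
    unfold pd
    rw [fderiv_clm_apply hd (differentiableAt_const _)]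
    simp
  funext y
  have hsymm : IsSymmSndFDerivAt ℂ F y := hF.contDiffAt.isSymmSndFDerivAt le_top
  rw [pd_pd, pd_pd, hsymm.eq]

theorem D3_right_comm {N : ℕ} {F : (Fin N → ℂ) → ℂ} (hF : ContDiff ℂ ⊤ F)
    (i p q : Fin N) (x : Fin N → ℂ) : D3 F i p q x = D3 F i q p x := by
  unfold D3
  rw [pd_comm hF]

/-- The commutativity equations, entrywise. -/
theorem sum_D3_mul_D3_sub_eq_zero {N : ℕ} {F : (Fin N → ℂ) → ℂ} (hF : ContDiff ℂ ⊤ F)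
    {x : Fin N → ℂ} {i j : Fin N} (hcomm : Fmat F i x * Fmat F j x = Fmat F j x * Fmat F i x)
    (p q : Fin N) :
    ∑ m, (D3 F i p m x * D3 F j q m x - D3 F j p m x * D3 F i q m x) = 0 := by
  have h := congrFun (congrFun hcomm p) q
  simp only [Matrix.mul_apply, Fmat, Matrix.of_apply] at h
  rw [Finset.sum_sub_distrib, sub_eq_zero]
  simpa only [D3_right_comm hF _ q] using h

/-- the 3×3 determinant identity for solutions of the
commutativity equations. -/
theorem stmt9 {N : ℕ} (F : (Fin N → ℂ) → ℂ) (hF : ContDiff ℂ ⊤ F)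
    (hcomm : ∀ x, ∀ i j : Fin N, Fmat F i x * Fmat F j x = Fmat F j x * Fmat F i x)
    (i₀ : Fin N) (a b c r t : Fin N) (hrt : r < t) (hr : r ≠ i₀) (ht : t ≠ i₀)
    (x : Fin N → ℂ) :
    Matrix.det !![D3 F a i₀ r x, D3 F b i₀ r x, D3 F c i₀ r x;
                  D3 F a i₀ t x, D3 F b i₀ t x, D3 F c i₀ t x;
                  D3 F a r t x,  D3 F b r t x,  D3 F c r t x] =
    - ∑ m ∈ Finset.univ.erase t,
        Matrix.det !![D3 F a i₀ r x, D3 F b i₀ r x, D3 F c i₀ r x;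
                      D3 F a i₀ m x, D3 F b i₀ m x, D3 F c i₀ m x;
                      D3 F a r m x,  D3 F b r m x,  D3 F c r m x] := by
  rw [eq_neg_iff_add_eq_zero, Finset.add_sum_erase Finset.univ (fun m =>
    Matrix.det !![D3 F a i₀ r x, D3 F b i₀ r x, D3 F c i₀ r x;
                  D3 F a i₀ m x, D3 F b i₀ m x, D3 F c i₀ m x;
                  D3 F a r m x,  D3 F b r m x,  D3 F c r m x]) (Finset.mem_univ t)]
  have hbc := sum_D3_mul_D3_sub_eq_zero hF (hcomm x b c) i₀ r
  have hca := sum_D3_mul_D3_sub_eq_zero hF (hcomm x c a) i₀ r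
  have hab := sum_D3_mul_D3_sub_eq_zero hF (hcomm x a b) i₀ r
  calc
    _ = ∑ m, (D3 F a i₀ r x * (D3 F b i₀ m x * D3 F c r m x - D3 F c i₀ m x * D3 F b r m x) +
          D3 F b i₀ r x * (D3 F c i₀ m x * D3 F a r m x - D3 F a i₀ m x * D3 F c r m x) +
          D3 F c i₀ r x * (D3 F a i₀ m x * D3 F b r m x - D3 F b i₀ m x * D3 F a r m x)) := by
      refine Finset.sum_congr rfl fun m _ => ?_
      simp [Matrix.det_fin_three]
      ring
    _ = 0 := by
      simp only [Finset.sum_add_distrib, ← Finset.mul_sum, hbc, hca, hab, mul_zero, add_zero]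
end

section
/- Let F = F(x^1,…,x^N) satisfy the commutativity equations F_i F_j = F_j F_i for all i,j. Fix i₀ and suppose the (N−1)×N matrix P = (F_{i₀ i j}) (rows i ≠ i₀) has rank N−1. Let A^k = (−1)^{k+1} det P_k and B_{ij} = Σ_k A^k F_{kij}. Then all diagonal entries of B are equal: B_{i₀ i₀} = B_{pp} for every p ∈ {1,…,N}. -/
open scoped BigOperators

/-- The `(N−1)×N` matrix `P = (F_{i₀ i j})` with rows indexed by `i ≠ i₀`
(in increasing order) and columns by `j = 1,…,N`. -/
noncomputable def Pmat {n : ℕ} (F : (Fin (n + 1) → ℂ) → ℂ) (i₀ : Fin (n + 1))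
    (x : Fin (n + 1) → ℂ) : Matrix (Fin n) (Fin (n + 1)) ℂ :=
  Matrix.of fun i j => D3 F i₀ (i₀.succAbove i) j x

/-- `A^k = (−1)^{k+1} det P_k` (with the 1-based sign convention of the paper,
so `(−1)^{k}` for the 0-based index `k`), where `P_k` is `P` with the `k`-th
column removed. -/
noncomputable def Acoef {n : ℕ} (F : (Fin (n + 1) → ℂ) → ℂ) (i₀ : Fin (n + 1))
    (x : Fin (n + 1) → ℂ) (k : Fin (n + 1)) : ℂ :=
  (-1 : ℂ) ^ (k : ℕ) *
    (Matrix.of fun i j : Fin n => Pmat F i₀ x i (k.succAbove j)).det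

/-- The matrix `B` with entries `B_{ij} = Σ_k A^k F_{kij}`. -/
noncomputable def Bmat {n : ℕ} (F : (Fin (n + 1) → ℂ) → ℂ) (i₀ : Fin (n + 1))
    (x : Fin (n + 1) → ℂ) : Matrix (Fin (n + 1)) (Fin (n + 1)) ℂ :=
  Matrix.of fun i j => ∑ k, Acoef F i₀ x k * D3 F k i j x


open scoped Matrix

theorem ContDiff.pd {N : ℕ} {f : (Fin N → ℂ) → ℂ} (hf : ContDiff ℂ ⊤ f) (i : Fin N) :
    ContDiff ℂ ⊤ (pd i f) :=
  (hf.fderiv_right (m := ⊤) le_top).clm_apply contDiff_const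

theorem pd_comm_s12 {N : ℕ} {f : (Fin N → ℂ) → ℂ} (hf : ContDiff ℂ ⊤ f) (i j : Fin N) :
    pd i (pd j f) = pd j (pd i f) := by
  have hd : Differentiable ℂ (fderiv ℂ f) :=
    (hf.fderiv_right (m := ⊤) le_top).differentiable (by simp)
  have key : ∀ (a b : Fin N) (x : Fin N → ℂ), pd a (pd b f) x
      = fderiv ℂ (fderiv ℂ f) x (Pi.single a 1) (Pi.single b 1) := by
    intro a b x
    unfold pd
    rw [fderiv_clm_apply (hd x) (differentiableAt_const _)]
    simp
  funext x
  rw [key, key]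
  exact (hf.contDiffAt.isSymmSndFDerivAt (by simp)) _ _

theorem D3_swap_left {N : ℕ} {F : (Fin N → ℂ) → ℂ} (hF : ContDiff ℂ ⊤ F) (i j k : Fin N)
    (x : Fin N → ℂ) : D3 F i j k x = D3 F j i k x :=
  congrFun (pd_comm_s12 (hF.pd k) i j) x

theorem D3_swap_right {N : ℕ} {F : (Fin N → ℂ) → ℂ} (hF : ContDiff ℂ ⊤ F) (i j k : Fin N)
    (x : Fin N → ℂ) : D3 F i j k x = D3 F i k j x := by
  unfold D3
  rw [pd_comm_s12 hF j k]

/-- The vector of signed maximal minors of an `n × (n + 1)` matrix lies in its kernel. -/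
theorem Matrix.sum_mul_signed_minor_eq_zero {R : Type*} [CommRing R] {n : ℕ}
    (P : Matrix (Fin n) (Fin (n + 1)) R) (i : Fin n) :
    ∑ k : Fin (n + 1), ((-1) ^ (k : ℕ) *
      (Matrix.of fun a b : Fin n => P a (k.succAbove b)).det) * P i k = 0 := by
  have h : (Matrix.of (Fin.cons (P i) P : Fin (n + 1) → Fin (n + 1) → R)).det = 0 :=
    Matrix.det_zero_of_row_eq (i := 0) (j := i.succ) (Fin.succ_ne_zero i).symm rfl
  rw [Matrix.det_succ_row_zero] at h
  rw [← h]
  refine Finset.sum_congr rfl fun k _ => ?_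
  rw [mul_right_comm]
  rfl

/-- If `P` consists of the rows of `M` other than the `i₀`-th and has full rank, then a vector
with vanishing `i₀`-th entry which is annihilated by `M` from the left is zero. -/
theorem Matrix.eq_zero_of_vecMul_eq_zero_of_rank {K : Type*} [Field K] {n : ℕ}
    (M : Matrix (Fin (n + 1)) (Fin (n + 1)) K) (i₀ : Fin (n + 1))
    (hrank : (M.submatrix i₀.succAbove id).rank = n) (d : Fin (n + 1) → K) (hd : d i₀ = 0)
    (hM : d ᵥ* M = 0) : d = 0 := by
  have hli : LinearIndependent K (M.submatrix i₀.succAbove id).row := by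
    rw [linearIndependent_iff_card_eq_finrank_span, Set.finrank,
      ← Matrix.rank_eq_finrank_span_row, hrank, Fintype.card_fin]
  have hinj := Matrix.vecMul_injective_iff.2 hli
  have hz : (fun i => d (i₀.succAbove i)) = 0 := by
    apply hinj
    funext j
    have := congrFun hM j
    simp only [Matrix.vecMul, dotProduct, Pi.zero_apply] at this
    rw [Fin.sum_univ_succAbove _ i₀, hd, zero_mul, zero_add] at this
    simpa [Matrix.vecMul, dotProduct] using this
  funext i
  rcases Fin.eq_self_or_eq_succAbove i₀ i with rfl | ⟨k, rfl⟩
  · exact hd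
  · exact congrFun hz k

theorem Bmat_eq_sum {n : ℕ} (F : (Fin (n + 1) → ℂ) → ℂ) (i₀ : Fin (n + 1))
    (x : Fin (n + 1) → ℂ) : Bmat F i₀ x = ∑ k, Acoef F i₀ x k • Fmat F k x := by
  ext i j
  simp [Bmat, Fmat, Matrix.sum_apply]

/-- The off-diagonal entries of column `i₀` of `B` vanish, so that the basis vector with index
`i₀` is an eigenvector of `B`. -/
theorem Bmat_apply_base {n : ℕ} {F : (Fin (n + 1) → ℂ) → ℂ} (hF : ContDiff ℂ ⊤ F)
    (i₀ : Fin (n + 1)) (x : Fin (n + 1) → ℂ) (i : Fin (n + 1)) (hi : i ≠ i₀) :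
    Bmat F i₀ x i i₀ = 0 := by
  obtain ⟨a, rfl⟩ := Fin.exists_succAbove_eq hi
  rw [← Matrix.sum_mul_signed_minor_eq_zero (Pmat F i₀ x) a]
  simp only [Bmat, Matrix.of_apply]
  refine Finset.sum_congr rfl fun k _ => ?_
  rw [D3_swap_right hF, D3_swap_left hF, D3_swap_right hF]
  rfl

/-- The matrix `B` is scalar. -/
theorem Bmat_eq_smul_one {n : ℕ} {F : (Fin (n + 1) → ℂ) → ℂ} (hF : ContDiff ℂ ⊤ F)
    (x : Fin (n + 1) → ℂ)
    (hcomm : ∀ i j : Fin (n + 1), Fmat F i x * Fmat F j x = Fmat F j x * Fmat F i x)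
    (i₀ : Fin (n + 1)) (hrank : (Pmat F i₀ x).rank = n) :
    Bmat F i₀ x = Bmat F i₀ x i₀ i₀ • (1 : Matrix (Fin (n + 1)) (Fin (n + 1)) ℂ) := by
  set B := Bmat F i₀ x with hB
  set D := B - B i₀ i₀ • (1 : Matrix (Fin (n + 1)) (Fin (n + 1)) ℂ) with hD
  have hDF : ∀ j, D * Fmat F j x = Fmat F j x * D := by
    intro j
    rw [hD, sub_mul, mul_sub, hB, Bmat_eq_sum, Finset.sum_mul, Finset.mul_sum]
    simp [hcomm _ j]
  have hDbase : ∀ i, D i i₀ = 0 := by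
    intro i
    by_cases hi : i = i₀
    · simp [hD, hi]
    · simp [hD, hi, hB, Bmat_apply_base hF i₀ x i hi]
  have hDM : D * Fmat F i₀ x = 0 := by
    ext i j
    have h := congrFun (congrFun (hDF j) i) i₀
    simp only [Matrix.mul_apply, hDbase, mul_zero, Finset.sum_const_zero] at h
    simp only [Matrix.mul_apply, Matrix.zero_apply]
    rw [← h]
    refine Finset.sum_congr rfl fun k _ => ?_
    simp only [Fmat, Matrix.of_apply]
    rw [D3_swap_left hF, D3_swap_right hF, D3_swap_left hF]
  have hzero : D = 0 := by
    funext i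
    refine Matrix.eq_zero_of_vecMul_eq_zero_of_rank (Fmat F i₀ x) i₀ hrank (D i) (hDbase i) ?_
    funext j
    exact congrFun (congrFun hDM i) j
  exact sub_eq_zero.1 hzero

/-- all diagonal entries of `B` are equal. -/
theorem stmt12 {n : ℕ} (F : (Fin (n + 1) → ℂ) → ℂ) (hF : ContDiff ℂ ⊤ F)
    (hcomm : ∀ x, ∀ i j : Fin (n + 1), Fmat F i x * Fmat F j x = Fmat F j x * Fmat F i x)
    (i₀ : Fin (n + 1)) (x : Fin (n + 1) → ℂ)
    (hrank : (Pmat F i₀ x).rank = n) :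
    ∀ p : Fin (n + 1), Bmat F i₀ x i₀ i₀ = Bmat F i₀ x p p := by
  intro p
  have h := congrFun (congrFun (Bmat_eq_smul_one hF x (hcomm x) i₀ hrank) p) p
  simpa using h.symm
end
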